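/- Under the stated assumptions, V_2(n) = |G_n|^{−1} Σ_{i∈G_{n−p_n}} Σ_{0≤ℓ<k≤p_n} E_{X_i}[M_{G_{p_n−ℓ}}(f̃_{ℓ,n}) M_{G_{p_n−k}}(f̃_{k,n})] converges (b_n²)-superexponentially fast in probability to 0; that is, for every δ > 0, limsup_n b_n^{−2} log P(|V_2(n)| > δ) = −∞. -/

import Mathlib

open MeasureTheory Filter ProbabilityTheory

noncomputable section

namespace BMC

/-- A vertex of the infinite binary tree is a finite word over `{0,1}`. -/
abbrev Word : Type := List Bool

/-- The `k`-th generation `G_k` of the binary tree. -/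
def gen (k : ℕ) : Finset Word :=
  (Finset.univ : Finset (Fin k → Bool)).image fun f => List.ofFn f

/-- The tree `T_k` up to generation `k`. -/
def tree (k : ℕ) : Finset Word := (Finset.range (k + 1)).biUnion gen

/-- The (lexicographic-genealogic) order on the binary tree: `i ≤ j` iff `i` is an
ancestor of `j`, or `v0` is an ancestor of `i` and `v1` an ancestor of `j` for some `v`. -/
def wle (i j : Word) : Prop :=
  i <+: j ∨ ∃ v : Word, (v ++ [false]) <+: i ∧ (v ++ [true]) <+: j

variable {d : ℕ}

/-- Euclidean norm on `Fin d → ℝ`. -/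
def enorm (x : Fin d → ℝ) : ℝ := Real.sqrt (∑ j, x j ^ 2)

/-- Action of the kernel `P` on a function of the pair of children. -/
def Pop (P : Kernel (Fin d → ℝ) ((Fin d → ℝ) × (Fin d → ℝ)))
    (h : (Fin d → ℝ) × (Fin d → ℝ) → ℝ) (x : Fin d → ℝ) : ℝ := ∫ p, h p ∂(P x)

/-- The mean kernel `Q = (P₀ + P₁)/2`, acting on functions. -/
def Qop (P : Kernel (Fin d → ℝ) ((Fin d → ℝ) × (Fin d → ℝ)))
    (f : (Fin d → ℝ) → ℝ) : (Fin d → ℝ) → ℝ :=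
  fun x => (∫ p, (f p.1 + f p.2) ∂(P x)) / 2

/-- The σ-field generated by the chain up to generation `k`. -/
def sigmaUpTo {Ω : Type*} [MeasurableSpace Ω] (X : Word → Ω → (Fin d → ℝ)) (k : ℕ) :
    MeasurableSpace Ω :=
  ⨆ j ∈ tree k, MeasurableSpace.comap (X j) inferInstance

/-- The σ-field `F_i` generated by `X_u` for `u ≤ i` in the tree order. -/
def Fsig {Ω : Type*} [MeasurableSpace Ω] (X : Word → Ω → (Fin d → ℝ)) (i : Word) :
    MeasurableSpace Ω :=
  ⨆ u ∈ {u : Word | wle u i}, MeasurableSpace.comap (X u) inferInstance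

/-- `X` is a bifurcating Markov chain with initial distribution `ν` and kernel `P`. -/
structure IsBMC {Ω : Type*} [MeasurableSpace Ω] (Pr : Measure Ω)
    (X : Word → Ω → (Fin d → ℝ)) (ν : Measure (Fin d → ℝ))
    (P : Kernel (Fin d → ℝ) ((Fin d → ℝ) × (Fin d → ℝ))) : Prop where
  meas : ∀ i, Measurable (X i)
  init : Pr.map (X []) = ν
  branching : ∀ (k : ℕ) (g : Word → (Fin d → ℝ) → (Fin d → ℝ) → (Fin d → ℝ) → ℝ),
    (∀ i, Measurable fun p : (Fin d → ℝ) × (Fin d → ℝ) × (Fin d → ℝ) => g i p.1 p.2.1 p.2.2) →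
    (∀ i, ∃ C, ∀ x y z, |g i x y z| ≤ C) →
    (Pr[(fun ω => ∏ i ∈ gen k, g i (X i ω) (X (i ++ [false]) ω) (X (i ++ [true]) ω))
        | sigmaUpTo X k]
      =ᵐ[Pr] fun ω => ∏ i ∈ gen k, ∫ p, g i (X i ω) p.1 p.2 ∂(P (X i ω)))

/-- Uniform geometric ergodicity of `Q` with invariant measure `μm`, rate `α`, constant `M`. -/
def ErgodicQ (P : Kernel (Fin d → ℝ) ((Fin d → ℝ) × (Fin d → ℝ)))
    (μm : Measure (Fin d → ℝ)) (M α : ℝ) : Prop :=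
  ∀ (f : (Fin d → ℝ) → ℝ) (C : ℝ), Measurable f → (∀ x, |f x| ≤ C) →
    ∀ (n : ℕ) (x : Fin d → ℝ), |(Qop P)^[n] f x - ∫ y, f y ∂μm| ≤ M * α ^ n * C

/-- `μm` is invariant for `Q`. -/
def IsInvariantQ (P : Kernel (Fin d → ℝ) ((Fin d → ℝ) × (Fin d → ℝ)))
    (μm : Measure (Fin d → ℝ)) : Prop :=
  ∀ f : (Fin d → ℝ) → ℝ, Measurable f → (∃ C, ∀ x, |f x| ≤ C) →
    ∫ x, Qop P f x ∂μm = ∫ x, f x ∂μm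

/-- The bandwidth `h_n = 2^{-nγ}`. -/
def bandwidth (γ : ℝ) (n : ℕ) : ℝ := (2 : ℝ) ^ (-(n : ℝ) * γ)

/-- The kernel density estimator `μ̂_{A}(x)` built from observations indexed by `A`. -/
def est {Ω : Type*} (K : (Fin d → ℝ) → ℝ) (X : Word → Ω → (Fin d → ℝ)) (γ : ℝ)
    (A : Finset Word) (n : ℕ) (x : Fin d → ℝ) (ω : Ω) : ℝ :=
  (A.card : ℝ)⁻¹ * (bandwidth γ n ^ (d : ℝ))⁻¹ *
    ∑ u ∈ A, K ((bandwidth γ n)⁻¹ • (x - X u ω))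

/-- One-dimensional `k`-th partial derivative of `f` in direction `j` at `x`. -/
def pder (f : (Fin d → ℝ) → ℝ) (j : Fin d) (k : ℕ) (x : Fin d → ℝ) : ℝ :=
  iteratedDeriv k (fun t => f (Function.update x j t)) (x j)

/-- `f` belongs to the isotropic Hölder class of order `s` with constant `L`. -/
def HolderClass (f : (Fin d → ℝ) → ℝ) (s L : ℝ) : Prop :=
  (∀ (j : Fin d) (x : Fin d → ℝ),
      ContDiff ℝ (⌊s⌋₊ : ℕ∞) fun t => f (Function.update x j t)) ∧
  ∀ (j : Fin d) (x : Fin d → ℝ) (t : ℝ),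
    |pder f j ⌊s⌋₊ (Function.update x j t) - pder f j ⌊s⌋₊ x| ≤
      L * |x j - t| ^ (s - (⌊s⌋₊ : ℝ))

/-- Regularity of the kernel function `K`. -/
def KernelReg (K : (Fin d → ℝ) → ℝ) : Prop :=
  Measurable K ∧ (∃ C, ∀ x, |K x| ≤ C) ∧ Integrable K volume ∧
    Integrable (fun x => K x ^ 2) volume ∧ (∫ x, K x) = 1 ∧
    ∀ ε > 0, ∃ R, ∀ x, R ≤ enorm x → |enorm x * K x| < ε

/-- `K` is of order `⌊s⌋`. -/
def KernelOrder (K : (Fin d → ℝ) → ℝ) (s : ℝ) : Prop :=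
  Integrable (fun x => enorm x ^ s * |K x|) volume ∧
    ∀ (j : Fin d) (k : ℕ), 1 ≤ k → k ≤ ⌊s⌋₊ →
      ∀ x : Fin d → ℝ, (∫ t : ℝ, t ^ k * K (Function.update x j t)) = 0

/-- Conditions (2.7) on the moderate deviation speed `b_n`. -/
def SpeedCond (b : ℕ → ℝ) (γ s : ℝ) (d : ℕ) : Prop :=
  (∀ n, 0 < b n) ∧ Tendsto b atTop atTop ∧
    Tendsto (fun n : ℕ => (n : ℝ) ^ (3 / 2 : ℝ) * b n /
      Real.sqrt (2 ^ n * bandwidth γ n ^ (d : ℝ))) atTop (nhds 0) ∧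
    Tendsto (fun n => b n /
      Real.sqrt (2 ^ n * bandwidth γ n ^ (2 * s + d))) atTop atTop

/-- `W` satisfies a moderate deviation principle with speed `b_n²` and rate function `I`. -/
def MDPseq {E Ω : Type*} [TopologicalSpace E] [MeasurableSpace E] [MeasurableSpace Ω]
    (Pr : Measure Ω) (W : ℕ → Ω → E) (b : ℕ → ℝ) (I : E → ℝ) : Prop :=
  ∀ A : Set E, MeasurableSet A →
    (-(⨅ y ∈ interior A, (I y : EReal)) ≤
      Filter.liminf
        (fun n => (((b n ^ 2)⁻¹ : ℝ) : EReal) * ENNReal.log (Pr {ω | W n ω ∈ A})) atTop) ∧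
    Filter.limsup
        (fun n => (((b n ^ 2)⁻¹ : ℝ) : EReal) * ENNReal.log (Pr {ω | W n ω ∈ A})) atTop ≤
      -(⨅ y ∈ closure A, (I y : EReal))

/-- `f` centered with respect to `μm`. -/
def tilde (μm : Measure (Fin d → ℝ)) (f : (Fin d → ℝ) → ℝ) (x : Fin d → ℝ) : ℝ :=
  f x - ∫ y, f y ∂μm

/-- `M_A(f) = Σ_{i ∈ A} f(X_i)`. -/
def MA {Ω : Type*} (X : Word → Ω → (Fin d → ℝ)) (A : Finset Word)
    (f : (Fin d → ℝ) → ℝ) (ω : Ω) : ℝ :=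
  ∑ i ∈ A, f (X i ω)

/-- Assumption 2.4 on the sequence of functions `𝔣_n = (f_{ℓ,n})`, where `f n ℓ = f_{ℓ,n}`. -/
def FnAssump (P : Kernel (Fin d → ℝ) ((Fin d → ℝ) × (Fin d → ℝ)))
    (μm : Measure (Fin d → ℝ)) (γ : ℝ) (f : ℕ → ℕ → (Fin d → ℝ) → ℝ) (σ2 : ℝ) : Prop :=
  (∀ n ℓ, Measurable (f n ℓ)) ∧
  (∀ n ℓ, n < ℓ → f n ℓ = 0) ∧
  (∃ C : ℝ, ∀ n : ℕ, ∀ ℓ ≤ n,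
    (∀ x, bandwidth γ n ^ ((d : ℝ) / 2) * |f n ℓ x| ≤ C) ∧
    (∀ x, |Qop P (f n ℓ) x| ≤ C * bandwidth γ n ^ ((d : ℝ) / 2)) ∧
    (∀ x, |Qop P (fun y => f n ℓ y ^ 2) x| ≤ C) ∧
    (∀ x, |Pop P (fun q => f n ℓ q.1 * f n ℓ q.2) x| ≤ C * bandwidth γ n ^ (d : ℝ))) ∧
  (∃ C : ℝ, ∀ n : ℕ, ∀ ℓ ≤ n,
    (∫ x, |f n ℓ x| ∂μm) ≤ C * bandwidth γ n ^ ((d : ℝ) / 2) ∧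
    (∫ x, f n ℓ x ^ 2 ∂μm) ≤ C) ∧
  Tendsto (fun n => ∑ ℓ ∈ Finset.range (n + 1), ((2 : ℝ)⁻¹) ^ ℓ * ∫ x, f n ℓ x ^ 2 ∂μm)
    atTop (nhds σ2)

/-- `N_{n,∅}(𝔣_n)`. -/
def Nempty {Ω : Type*} (X : Word → Ω → (Fin d → ℝ)) (μm : Measure (Fin d → ℝ))
    (f : ℕ → ℕ → (Fin d → ℝ) → ℝ) (n : ℕ) (ω : Ω) : ℝ :=
  (Real.sqrt (2 ^ n))⁻¹ * ∑ ℓ ∈ Finset.range (n + 1), MA X (gen (n - ℓ)) (tilde μm (f n ℓ)) ω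

/-- Conditions on the auxiliary sequence `p_n`. -/
def PCond (p : ℕ → ℕ) (b : ℕ → ℝ) : Prop :=
  Monotone p ∧ (∀ n, 1 ≤ p n) ∧ (∀ n, 1 ≤ n → p n ≤ n) ∧
    Tendsto (fun n => (p n : ℝ) ^ 3 * b n ^ 2 / 2 ^ (n - p n : ℕ)) atTop (nhds 0)

/-- `N_{n,i}(𝔣_n)` for `i ∈ G_{n-p_n}`. -/
def Nni {Ω : Type*} (X : Word → Ω → (Fin d → ℝ)) (μm : Measure (Fin d → ℝ))
    (f : ℕ → ℕ → (Fin d → ℝ) → ℝ) (p : ℕ → ℕ) (n : ℕ) (i : Word) (ω : Ω) : ℝ :=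
  (Real.sqrt (2 ^ n))⁻¹ * ∑ ℓ ∈ Finset.range (p n + 1),
    ∑ j ∈ gen (p n - ℓ), tilde μm (f n ℓ) (X (i ++ j) ω)

/-- The martingale increment `Δ_{n,i}(𝔣_n)`. -/
def Dni {Ω : Type*} [MeasurableSpace Ω] (Pr : Measure Ω) (X : Word → Ω → (Fin d → ℝ))
    (μm : Measure (Fin d → ℝ)) (f : ℕ → ℕ → (Fin d → ℝ) → ℝ) (p : ℕ → ℕ)
    (n : ℕ) (i : Word) (ω : Ω) : ℝ :=
  Nni X μm f p n i ω - (Pr[Nni X μm f p n i | Fsig X i]) ω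

/-- Bounded measurable functions. -/
def BddMeas {S : Type*} [MeasurableSpace S] (u : S → ℝ) : Prop :=
  Measurable u ∧ ∃ C, ∀ x, |u x| ≤ C

namespace BddMeas

variable {S : Type*} [MeasurableSpace S] {u v : S → ℝ}

theorem comp {T : Type*} [MeasurableSpace T] (hu : BddMeas u) {φ : T → S} (hφ : Measurable φ) :
    BddMeas fun t => u (φ t) :=
  ⟨hu.1.comp hφ, hu.2.imp fun _ h t => h (φ t)⟩

theorem const (c : ℝ) : BddMeas fun _ : S => c := ⟨measurable_const, |c|, fun _ => le_rfl⟩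

theorem add (hu : BddMeas u) (hv : BddMeas v) : BddMeas fun x => u x + v x := by
  obtain ⟨A, hA⟩ := hu.2
  obtain ⟨B, hB⟩ := hv.2
  exact ⟨hu.1.add hv.1, A + B, fun x => (abs_add_le _ _).trans (add_le_add (hA x) (hB x))⟩

theorem mul (hu : BddMeas u) (hv : BddMeas v) : BddMeas fun x => u x * v x := by
  obtain ⟨A, hA⟩ := hu.2
  obtain ⟨B, hB⟩ := hv.2
  refine ⟨hu.1.mul hv.1, A * B, fun x => ?_⟩
  rw [abs_mul]
  exact mul_le_mul (hA x) (hB x) (abs_nonneg _) ((abs_nonneg _).trans (hA x))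

theorem abs (hu : BddMeas u) : BddMeas fun x => |u x| :=
  ⟨hu.1.abs, hu.2.imp fun _ h x => (abs_abs (u x)).trans_le (h x)⟩

theorem sub (hu : BddMeas u) (hv : BddMeas v) : BddMeas fun x => u x - v x := by
  simpa [sub_eq_add_neg] using hu.add ((const (-1)).mul hv)

theorem sum {ι : Type*} (s : Finset ι) {u : ι → S → ℝ} (hu : ∀ i ∈ s, BddMeas (u i)) :
    BddMeas fun x => ∑ i ∈ s, u i x := by
  classical
  induction s using Finset.induction_on with
  | empty => simpa using const (S := S) 0
  | insert a s ha ih =>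
    simp only [Finset.sum_insert ha]
    exact (hu a (Finset.mem_insert_self a s)).add
      (ih fun i hi => hu i (Finset.mem_insert_of_mem hi))

theorem integrable (hu : BddMeas u) (μ : Measure S) [IsFiniteMeasure μ] : Integrable u μ := by
  obtain ⟨C, hC⟩ := hu.2
  exact Integrable.of_bound hu.1.aestronglyMeasurable C (ae_of_all _ hC)

theorem exp (hu : BddMeas u) : BddMeas fun x => Real.exp (u x) := by
  obtain ⟨C, hC⟩ := hu.2
  refine ⟨hu.1.exp, Real.exp C, fun x => ?_⟩
  rw [abs_of_pos (Real.exp_pos _)]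
  exact Real.exp_le_exp.2 ((le_abs_self _).trans (hC x))

end BddMeas

theorem abs_integral_le_of_abs_le {S : Type*} [MeasurableSpace S] (μ : Measure S)
    [IsProbabilityMeasure μ] {u : S → ℝ} {C : ℝ} (h : ∀ x, |u x| ≤ C) : |∫ x, u x ∂μ| ≤ C := by
  simpa using norm_integral_le_of_norm_le_const (f := u) (ae_of_all μ h)

section Operators

variable {P : Kernel (Fin d → ℝ) ((Fin d → ℝ) × (Fin d → ℝ))}
  {u v : (Fin d → ℝ) → ℝ} {G H : (Fin d → ℝ) × (Fin d → ℝ) → ℝ}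

theorem BddMeas.children (hu : BddMeas u) :
    BddMeas fun q : (Fin d → ℝ) × (Fin d → ℝ) => u q.1 + u q.2 :=
  (hu.comp measurable_fst).add (hu.comp measurable_snd)

theorem two_mul_Qop (x : Fin d → ℝ) : 2 * Qop P u x = Pop P (fun q => u q.1 + u q.2) x := by
  simp only [Qop, Pop]; ring

theorem Qop_eq (x : Fin d → ℝ) : Qop P u x = 2⁻¹ * Pop P (fun q => u q.1 + u q.2) x := by
  rw [← two_mul_Qop]; ring

theorem Pop_const_mul (c : ℝ) (x : Fin d → ℝ) :
    Pop P (fun q => c * G q) x = c * Pop P G x := integral_const_mul _ _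

theorem abs_Pop_le (x : Fin d → ℝ) :
    |Pop P G x| ≤ Pop P (fun q => |G q|) x := abs_integral_le_integral_abs

theorem Qop_const_mul (c : ℝ) (x : Fin d → ℝ) :
    Qop P (fun y => c * u y) x = c * Qop P u x := by
  simp only [Qop_eq, ← mul_add, Pop_const_mul]
  ring

variable [IsMarkovKernel P]

theorem BddMeas.pop (hG : BddMeas G) : BddMeas (Pop P G) := by
  obtain ⟨C, hC⟩ := hG.2
  exact ⟨(hG.1.stronglyMeasurable.integral_kernel).measurable, C,
    fun x => abs_integral_le_of_abs_le _ hC⟩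

theorem BddMeas.qop (hu : BddMeas u) : BddMeas (Qop P u) := by
  rw [funext (Qop_eq (P := P) (u := u))]
  exact (BddMeas.const _).mul hu.children.pop

theorem BddMeas.qop_iterate (hu : BddMeas u) (q : ℕ) : BddMeas ((Qop P)^[q] u) := by
  induction q with
  | zero => exact hu
  | succ q ih => rw [Function.iterate_succ_apply']; exact ih.qop

theorem Pop_mono (hG : BddMeas G) (hH : BddMeas H) (h : ∀ q, G q ≤ H q) (x : Fin d → ℝ) :
    Pop P G x ≤ Pop P H x :=
  integral_mono (hG.integrable _) (hH.integrable _) h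

theorem Qop_mono (hu : BddMeas u) (hv : BddMeas v) (h : ∀ x, u x ≤ v x) (x : Fin d → ℝ) :
    Qop P u x ≤ Qop P v x := by
  rw [Qop_eq, Qop_eq]
  have := Pop_mono (P := P) hu.children hv.children (fun q => add_le_add (h q.1) (h q.2)) x
  linarith

theorem abs_Qop_le (hu : BddMeas u) (x : Fin d → ℝ) : |Qop P u x| ≤ Qop P (fun y => |u y|) x := by
  rw [Qop_eq, Qop_eq, abs_mul, abs_of_pos (by norm_num : (0 : ℝ) < 2⁻¹)]
  refine mul_le_mul_of_nonneg_left ((abs_Pop_le x).trans ?_) (by norm_num)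
  exact Pop_mono hu.children.abs hu.abs.children (fun q => abs_add_le _ _) x

theorem Qop_add_const (hu : BddMeas u) (c : ℝ) (x : Fin d → ℝ) :
    Qop P (fun y => u y + c) x = Qop P u x + c := by
  simp only [Qop]
  rw [show (fun p : (Fin d → ℝ) × (Fin d → ℝ) => u p.1 + c + (u p.2 + c)) =
    fun p => (u p.1 + u p.2) + 2 * c by ext; ring,
    integral_add (hu.children.integrable _) (integrable_const _)]
  simp [add_div]

theorem abs_Qop_le_of_abs_le {C : ℝ} (h : ∀ x, |u x| ≤ C) (x : Fin d → ℝ) : |Qop P u x| ≤ C := by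
  rw [Qop_eq, abs_mul, abs_of_pos (by norm_num : (0 : ℝ) < 2⁻¹)]
  have : |Pop P (fun q => u q.1 + u q.2) x| ≤ C + C :=
    abs_integral_le_of_abs_le _ fun q => (abs_add_le _ _).trans (add_le_add (h _) (h _))
  linarith

end Operators

section Tree

theorem mem_gen {k : ℕ} {w : Word} : w ∈ gen k ↔ w.length = k := by
  simp only [gen, Finset.mem_image, Finset.mem_univ, true_and]
  constructor
  · rintro ⟨f, rfl⟩; simp
  · rintro rfl; exact ⟨w.get, List.ofFn_get w⟩

theorem gen_zero : gen 0 = {[]} := by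
  ext w; simp [mem_gen]

theorem card_gen (k : ℕ) : (gen k).card = 2 ^ k := by
  rw [gen, Finset.card_image_of_injective _ List.ofFn_injective]
  simp

theorem sum_gen_succ (k : ℕ) (φ : Word → ℝ) :
    ∑ j ∈ gen (k + 1), φ j = ∑ i ∈ gen k, (φ (i ++ [false]) + φ (i ++ [true])) := by
  have h : gen (k + 1) = (gen k ×ˢ (Finset.univ : Finset Bool)).image fun q => q.1 ++ [q.2] := by
    ext w
    simp only [mem_gen, Finset.mem_image, Finset.mem_product, Finset.mem_univ, and_true,
      Prod.exists]
    constructor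
    · intro hw
      have hne : w ≠ [] := by rintro rfl; simp at hw
      exact ⟨w.dropLast, w.getLast hne, by simp [hw], List.dropLast_append_getLast hne⟩
    · rintro ⟨i, e, hi, rfl⟩; simp [hi]
  rw [h, Finset.sum_image, Finset.sum_product]
  · refine Finset.sum_congr rfl fun i _ => ?_
    rw [Fintype.sum_bool, add_comm]
  · rintro ⟨i, e⟩ _ ⟨j, e'⟩ _ hij
    simpa using hij

end Tree

theorem MA_gen_succ {Ω : Type*} (X : Word → Ω → (Fin d → ℝ)) (u : (Fin d → ℝ) → ℝ) (k : ℕ) (ω : Ω) :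
    MA X (gen (k + 1)) u ω =
      ∑ i ∈ gen k, (u (X (i ++ [false]) ω) + u (X (i ++ [true]) ω)) :=
  sum_gen_succ k _

section Moments

variable {Ω : Type*} [MeasurableSpace Ω] {Pr : Measure Ω} {X : Word → Ω → (Fin d → ℝ)}
  {ν : Measure (Fin d → ℝ)} {P : Kernel (Fin d → ℝ) ((Fin d → ℝ) × (Fin d → ℝ))}
  {u v : (Fin d → ℝ) → ℝ} {G H : (Fin d → ℝ) × (Fin d → ℝ) → ℝ} {k : ℕ} {i j : Word}

theorem sigmaUpTo_le (hX : ∀ i, Measurable (X i)) (k : ℕ) :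
    sigmaUpTo X k ≤ (inferInstance : MeasurableSpace Ω) :=
  iSup₂_le fun j _ => (hX j).comap_le

theorem measurable_sigmaUpTo {r : ℕ} (hj : j ∈ gen r) (hr : r ≤ k) :
    Measurable[sigmaUpTo X k] (X j) := by
  have hjk : j ∈ tree k :=
    Finset.mem_biUnion.2 ⟨r, Finset.mem_range.2 (Nat.lt_succ_of_le hr), hj⟩
  exact (comap_measurable (X j)).mono
    (le_iSup₂ (f := fun j (_ : j ∈ tree k) => MeasurableSpace.comap (X j) inferInstance) j hjk)
    le_rfl

theorem BddMeas.MA (hX : ∀ i, Measurable (X i)) (hu : BddMeas u) (A : Finset Word) :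
    BddMeas (MA X A u) :=
  BddMeas.sum A fun i _ => hu.comp (hX i)

variable [IsProbabilityMeasure Pr]

theorem abs_integral_MA_le {B : ℝ} (h : ∀ x, |u x| ≤ B) (k : ℕ) :
    |∫ ω, MA X (gen k) u ω ∂Pr| ≤ 2 ^ k * B := by
  refine abs_integral_le_of_abs_le _ fun ω => (Finset.abs_sum_le_sum_abs _ _).trans ?_
  refine (Finset.sum_le_card_nsmul _ _ B fun i _ => h _).trans ?_
  simp [card_gen]

theorem IsBMC.integral_prod_children (hX : IsBMC Pr X ν P) (k : ℕ)
    (g : Word → (Fin d → ℝ) × (Fin d → ℝ) → ℝ) (hg : ∀ i, BddMeas (g i)) :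
    ∫ ω, ∏ i ∈ gen k, g i (X (i ++ [false]) ω, X (i ++ [true]) ω) ∂Pr =
      ∫ ω, ∏ i ∈ gen k, Pop P (g i) (X i ω) ∂Pr := by
  have h := hX.branching k (fun i _ y z => g i (y, z)) (fun i => (hg i).1.comp measurable_snd)
    (fun i => (hg i).2.imp fun _ h _ y z => h (y, z))
  rw [← integral_condExp (sigmaUpTo_le hX.meas k)]
  exact integral_congr_ae h

variable [IsMarkovKernel P]

theorem IsBMC.integral_mul_children (hX : IsBMC Pr X ν P) (hi : i ∈ gen k) {Z : Ω → ℝ}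
    (hZm : Measurable[sigmaUpTo X k] Z) (hZ : BddMeas Z) (hG : BddMeas G) :
    ∫ ω, Z ω * G (X (i ++ [false]) ω, X (i ++ [true]) ω) ∂Pr =
      ∫ ω, Z ω * Pop P G (X i ω) ∂Pr := by
  have h := hX.branching k (fun w _ y z => if w = i then G (y, z) else 1)
    (fun w => by
      by_cases hw : w = i
      · simpa [hw, Function.comp_def] using hG.1.comp measurable_snd
      · simp [hw])
    (fun w => by
      by_cases hw : w = i
      · simpa [hw] using hG.2.imp fun _ h (_ : Fin d → ℝ) y z => h (y, z)
      · exact ⟨1, by simp [hw]⟩)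
  have hint : ∀ (w : Word) (x : Fin d → ℝ),
      ∫ p, (if w = i then G (p.1, p.2) else 1) ∂(P x) = if w = i then Pop P G x else 1 := by
    intro w x
    by_cases hw : w = i <;> simp [hw, Pop]
  simp only [hint, Finset.prod_ite_eq', hi, if_true] at h
  have hc : BddMeas fun ω => G (X (i ++ [false]) ω, X (i ++ [true]) ω) :=
    hG.comp ((hX.meas _).prodMk (hX.meas _))
  rw [← integral_condExp (sigmaUpTo_le hX.meas k)]
  refine integral_congr_ae ?_
  have h2 := condExp_mul_of_stronglyMeasurable_left (μ := Pr) hZm.stronglyMeasurable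
    ((hZ.mul hc).integrable Pr) (hc.integrable Pr)
  exact h2.trans (h.mono fun ω hω => by simp only [Pi.mul_apply, hω])

theorem IsBMC.integral_children_mul_children (hX : IsBMC Pr X ν P) (hi : i ∈ gen k)
    (hj : j ∈ gen k) (hij : i ≠ j) (hG : BddMeas G) (hH : BddMeas H) :
    ∫ ω, G (X (i ++ [false]) ω, X (i ++ [true]) ω) *
        H (X (j ++ [false]) ω, X (j ++ [true]) ω) ∂Pr =
      ∫ ω, Pop P G (X i ω) * Pop P H (X j ω) ∂Pr := by
  have h := hX.integral_prod_children k
    (fun w q => (if w = i then G q else 1) * (if w = j then H q else 1)) fun w => by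
      by_cases hw : w = i
      · have : w ≠ j := hw ▸ hij
        simpa [hw, hij] using hG
      · by_cases hw' : w = j
        · simpa [hw', hij.symm] using hH
        · simpa [hw, hw'] using BddMeas.const 1
  have hint : ∀ (w : Word) (x : Fin d → ℝ),
      Pop P (fun q => (if w = i then G q else 1) * (if w = j then H q else 1)) x =
        (if w = i then Pop P G x else 1) * (if w = j then Pop P H x else 1) := by
    intro w x
    by_cases hw : w = i
    · simp [hw, hij, Pop]
    · by_cases hw' : w = j
      · simp [hw', hij.symm, Pop]
      · simp [hw, hw', Pop]
  simpa only [hint, Finset.prod_mul_distrib, Finset.prod_ite_eq', hi, hj, if_true] using h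

/-- The covariance operator of the offspring sums of `u` and `v`. -/
def offspringCov (P : Kernel (Fin d → ℝ) ((Fin d → ℝ) × (Fin d → ℝ)))
    (u v : (Fin d → ℝ) → ℝ) (x : Fin d → ℝ) : ℝ :=
  Pop P (fun q => (u q.1 + u q.2) * (v q.1 + v q.2)) x - 4 * (Qop P u x * Qop P v x)

theorem BddMeas.offspringCov (hu : BddMeas u) (hv : BddMeas v) :
    BddMeas (offspringCov P u v) :=
  (hu.children.mul hv.children).pop.sub ((BddMeas.const 4).mul (hu.qop.mul hv.qop))

theorem abs_offspringCov_le (hu : BddMeas u) (hv : BddMeas v) {A B : ℝ}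
    (hA : ∀ x, Qop P (fun y => |u y|) x ≤ A) (hB : ∀ x, |v x| ≤ B) (x : Fin d → ℝ) :
    |offspringCov P u v x| ≤ 8 * (A * B) := by
  have hB0 : 0 ≤ B := (abs_nonneg _).trans (hB 0)
  have hA0 : 0 ≤ A := (abs_nonneg _).trans ((abs_Qop_le hu x).trans (hA x))
  have h1 : |Pop P (fun q => (u q.1 + u q.2) * (v q.1 + v q.2)) x| ≤ 4 * (A * B) := by
    calc _ ≤ Pop P (fun q => |(u q.1 + u q.2) * (v q.1 + v q.2)|) x := abs_Pop_le x
      _ ≤ Pop P (fun q => (2 * B) * (|u q.1| + |u q.2|)) x := by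
          refine Pop_mono (hu.children.mul hv.children).abs
            ((BddMeas.const _).mul hu.abs.children) (fun q => ?_) x
          rw [abs_mul, mul_comm]
          refine mul_le_mul ?_ (abs_add_le _ _) (abs_nonneg _) (by positivity)
          exact (abs_add_le _ _).trans (by linarith [hB q.1, hB q.2])
      _ = 4 * (Qop P (fun y => |u y|) x * B) := by
          rw [Pop_const_mul, ← two_mul_Qop (u := fun y => |u y|)]; ring
      _ ≤ 4 * (A * B) := by gcongr; exact hA x
  have h2 : |Qop P u x * Qop P v x| ≤ A * B := by
    rw [abs_mul]
    exact mul_le_mul ((abs_Qop_le hu x).trans (hA x)) (abs_Qop_le_of_abs_le hB x)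
      (abs_nonneg _) hA0
  refine (abs_sub _ _).trans ?_
  rw [abs_mul, abs_of_pos (by norm_num : (0 : ℝ) < 4)]
  linarith

theorem IsBMC.integral_MA_succ_mul_MA (hX : IsBMC Pr X ν P) (hu : BddMeas u) (hv : BddMeas v)
    {r : ℕ} (hr : r ≤ k) :
    ∫ ω, MA X (gen (k + 1)) u ω * MA X (gen r) v ω ∂Pr =
      2 * ∫ ω, MA X (gen k) (Qop P u) ω * MA X (gen r) v ω ∂Pr := by
  have hZ : BddMeas (MA X (gen r) v) := hv.MA hX.meas _
  have hZm : Measurable[sigmaUpTo X k] (MA X (gen r) v) :=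
    Finset.measurable_fun_sum _ fun i hi => hv.1.comp (measurable_sigmaUpTo hi hr)
  have hR : ∀ ω, 2 * (MA X (gen k) (Qop P u) ω * MA X (gen r) v ω) =
      ∑ i ∈ gen k, MA X (gen r) v ω * Pop P (fun q => u q.1 + u q.2) (X i ω) := by
    intro ω
    rw [← Finset.mul_sum, ← mul_assoc, mul_comm, MA.eq_1 X (gen k), Finset.mul_sum]
    simp only [two_mul_Qop]
  have hL : ∀ ω, MA X (gen (k + 1)) u ω * MA X (gen r) v ω =
      ∑ i ∈ gen k, MA X (gen r) v ω * (u (X (i ++ [false]) ω) + u (X (i ++ [true]) ω)) := by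
    intro ω
    rw [← Finset.mul_sum, MA_gen_succ, mul_comm]
  rw [← integral_const_mul]
  simp only [hR, hL]
  rw [integral_finsetSum _ fun i _ => ?_, integral_finsetSum _ fun i _ => ?_]
  · exact Finset.sum_congr rfl fun i hi => hX.integral_mul_children hi hZm hZ hu.children
  · exact (hZ.mul (hu.children.pop.comp (hX.meas i))).integrable _
  · exact (hZ.mul (hu.children.comp ((hX.meas _).prodMk (hX.meas _)))).integrable _

theorem IsBMC.integral_MA_add_mul_MA (hX : IsBMC Pr X ν P) (hu : BddMeas u) (hv : BddMeas v)
    (r t : ℕ) :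
    ∫ ω, MA X (gen (r + t)) u ω * MA X (gen r) v ω ∂Pr =
      2 ^ t * ∫ ω, MA X (gen r) ((Qop P)^[t] u) ω * MA X (gen r) v ω ∂Pr := by
  induction t generalizing u with
  | zero => simp
  | succ t ih =>
    rw [← add_assoc, hX.integral_MA_succ_mul_MA hu hv (Nat.le_add_right r t), ih hu.qop,
      Function.iterate_succ_apply, pow_succ]
    ring

theorem IsBMC.integral_MA_succ_mul_MA_succ (hX : IsBMC Pr X ν P) (hu : BddMeas u)
    (hv : BddMeas v) (k : ℕ) :
    ∫ ω, MA X (gen (k + 1)) u ω * MA X (gen (k + 1)) v ω ∂Pr =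
      4 * ∫ ω, MA X (gen k) (Qop P u) ω * MA X (gen k) (Qop P v) ω ∂Pr +
        ∫ ω, MA X (gen k) (offspringCov P u v) ω ∂Pr := by
  have hc : ∀ i, BddMeas fun ω => u (X (i ++ [false]) ω) + u (X (i ++ [true]) ω) := fun i =>
    hu.children.comp ((hX.meas _).prodMk (hX.meas _))
  have hc' : ∀ i, BddMeas fun ω => v (X (i ++ [false]) ω) + v (X (i ++ [true]) ω) := fun i =>
    hv.children.comp ((hX.meas _).prodMk (hX.meas _))
  have hq : ∀ i, BddMeas fun ω => Qop P u (X i ω) := fun i => hu.qop.comp (hX.meas i)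
  have hq' : ∀ i, BddMeas fun ω => Qop P v (X i ω) := fun i => hv.qop.comp (hX.meas i)
  have hD : ∀ i, BddMeas fun ω => offspringCov P u v (X i ω) := fun i =>
    (hu.offspringCov hv).comp (hX.meas i)
  have key : ∀ i ∈ gen k, ∀ j ∈ gen k,
      ∫ ω, (u (X (i ++ [false]) ω) + u (X (i ++ [true]) ω)) *
        (v (X (j ++ [false]) ω) + v (X (j ++ [true]) ω)) ∂Pr =
      4 * ∫ ω, Qop P u (X i ω) * Qop P v (X j ω) ∂Pr +
        if j = i then ∫ ω, offspringCov P u v (X i ω) ∂Pr else 0 := by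
    intro i hi j hj
    rw [← integral_const_mul]
    by_cases hij : j = i
    · subst hij
      rw [if_pos rfl, ← integral_add (((BddMeas.const 4).mul ((hq j).mul (hq' j))).integrable _)
        ((hD j).integrable _)]
      simp only [offspringCov, add_sub_cancel]
      simpa using hX.integral_mul_children (Z := fun _ => 1) hj measurable_const
        (BddMeas.const 1) (hu.children.mul hv.children)
    · rw [if_neg hij, add_zero, hX.integral_children_mul_children hi hj (Ne.symm hij)
        hu.children hv.children]
      refine integral_congr_ae (ae_of_all _ fun ω => ?_)
      simp only [← two_mul_Qop]
      ring
  simp only [MA_gen_succ, Finset.sum_mul_sum]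
  simp only [MA, Finset.sum_mul_sum]
  rw [integral_finsetSum _ fun i _ => (BddMeas.sum _ fun j _ => (hc i).mul (hc' j)).integrable _,
    integral_finsetSum _ fun i _ => (BddMeas.sum _ fun j _ => (hq i).mul (hq' j)).integrable _,
    integral_finsetSum _ fun i _ => (hD i).integrable _, Finset.mul_sum,
    ← Finset.sum_add_distrib]
  refine Finset.sum_congr rfl fun i hi => ?_
  rw [integral_finsetSum _ fun j _ => ((hc i).mul (hc' j)).integrable _,
    integral_finsetSum _ fun j _ => ((hq i).mul (hq' j)).integrable _,
    Finset.sum_congr rfl (key i hi), Finset.sum_add_distrib, Finset.mul_sum,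
    Finset.sum_ite_eq' (gen k) i, if_pos hi]

theorem IsBMC.abs_integral_MA_succ_mul_MA_succ_le (hX : IsBMC Pr X ν P) (hu : BddMeas u)
    (hv : BddMeas v) {A B : ℝ} (hA : ∀ x, Qop P (fun y => |u y|) x ≤ A) (hB : ∀ x, |v x| ≤ B)
    (k : ℕ) :
    |∫ ω, MA X (gen (k + 1)) u ω * MA X (gen (k + 1)) v ω ∂Pr| ≤
      4 * |∫ ω, MA X (gen k) (Qop P u) ω * MA X (gen k) (Qop P v) ω ∂Pr| +
        2 ^ k * (8 * (A * B)) := by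
  rw [hX.integral_MA_succ_mul_MA_succ hu hv]
  refine (abs_add_le _ _).trans ?_
  rw [abs_mul, abs_of_pos (by norm_num : (0 : ℝ) < 4)]
  gcongr
  exact abs_integral_MA_le (abs_offspringCov_le hu hv hA hB) k

/-- Second-moment bound over one generation for functions contracted by `Q` at rate `α`. -/
theorem IsBMC.abs_integral_MA_mul_MA_le (hX : IsBMC Pr X ν P) (hu : BddMeas u) (hv : BddMeas v)
    {α A B θ : ℝ} (hθ1 : 1 ≤ θ) (hθ : 2 * α ^ 2 ≤ θ)
    (hA : ∀ q x, |(Qop P)^[q] u x| ≤ A * α ^ q) (hB : ∀ q x, |(Qop P)^[q] v x| ≤ B * α ^ q)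
    (r : ℕ) :
    |∫ ω, MA X (gen r) u ω * MA X (gen r) v ω ∂Pr| ≤
      A * B * (2 ^ r * ((4 * r + 1) * θ ^ r)) := by
  induction r generalizing u v A B with
  | zero =>
    refine abs_integral_le_of_abs_le _ fun ω => ?_
    simp only [MA, gen_zero, Finset.sum_singleton, abs_mul]
    have h1 := hA 0 (X [] ω)
    have h2 := hB 0 (X [] ω)
    simp only [Function.iterate_zero, id, pow_zero, mul_one] at h1 h2
    simpa using mul_le_mul h1 h2 (abs_nonneg _) ((abs_nonneg _).trans h1)
  | succ r ih =>
    have h1 : ∀ x, |u x| ≤ A := by simpa using hA 0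
    have h2 : ∀ x, |v x| ≤ B := by simpa using hB 0
    have hA0 : 0 ≤ A := (abs_nonneg _).trans (h1 0)
    have hB0 : 0 ≤ B := (abs_nonneg _).trans (h2 0)
    have hQ : ∀ x, Qop P (fun y => |u y|) x ≤ A := fun x =>
      (le_abs_self _).trans (abs_Qop_le_of_abs_le (fun y => by simpa using h1 y) x)
    refine (hX.abs_integral_MA_succ_mul_MA_succ_le hu hv hQ h2 r).trans ?_
    have h3 := ih (A := A * α) (B := B * α) hu.qop hv.qop
      (fun q x => by
        rw [← Function.iterate_succ_apply, mul_assoc, ← pow_succ']; exact hA (q + 1) x)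
      (fun q x => by
        rw [← Function.iterate_succ_apply, mul_assoc, ← pow_succ']; exact hB (q + 1) x)
    have hAB : 0 ≤ A * B * 2 ^ r := by positivity
    have h4 : 2 * α ^ 2 * ((4 * r + 1) * θ ^ r) ≤ θ * ((4 * r + 1) * θ ^ r) := by gcongr
    have h5 : 1 ≤ θ ^ (r + 1) := one_le_pow₀ hθ1
    have h6 : 2 * α ^ 2 * ((4 * r + 1) * θ ^ r) + 4 ≤ (4 * (r + 1) + 1) * θ ^ (r + 1) := by
      rw [show θ * ((4 * (r : ℝ) + 1) * θ ^ r) = (4 * r + 1) * θ ^ (r + 1) by ring] at h4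
      linarith
    calc _ ≤ 4 * (A * α * (B * α) * (2 ^ r * ((4 * r + 1) * θ ^ r))) +
          2 ^ r * (8 * (A * B)) := by gcongr
      _ = A * B * 2 ^ r * (2 * (2 * α ^ 2 * ((4 * r + 1) * θ ^ r) + 4)) := by ring
      _ ≤ A * B * 2 ^ r * (2 * ((4 * (r + 1) + 1) * θ ^ (r + 1))) := by gcongr
      _ = _ := by push_cast; ring

end Moments

theorem IsBMC.measure_le_MA_le {Ω : Type*} [MeasurableSpace Ω] {Pr : Measure Ω}
    [IsProbabilityMeasure Pr] {X : Word → Ω → (Fin d → ℝ)} {ν : Measure (Fin d → ℝ)}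
    {P : Kernel (Fin d → ℝ) ((Fin d → ℝ) × (Fin d → ℝ))} [IsMarkovKernel P]
    (hX : IsBMC Pr X ν P) {w : (Fin d → ℝ) → ℝ} (hw : BddMeas w) (h0 : ∀ x, 0 ≤ w x) {K η : ℝ}
    (hK : ∀ x, w x ≤ K) (hη : ∀ x, Qop P w x ≤ η) (k : ℕ) (t : ℝ) :
    Pr {ω | t * 2 ^ (k + 1) ≤ MA X (gen (k + 1)) w ω} ≤
      ENNReal.ofReal (Real.exp (-(2 ^ (k + 1) * (t - Real.exp (2 * K) * η)))) := by
  have hG : BddMeas fun q : (Fin d → ℝ) × (Fin d → ℝ) => Real.exp (w q.1 + w q.2) :=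
    hw.children.exp
  have hpop : ∀ x, Pop P (fun q => Real.exp (w q.1 + w q.2)) x ≤
      Real.exp (2 * (Real.exp (2 * K) * η)) := by
    intro x
    calc _ ≤ Pop P (fun q => 1 + Real.exp (2 * K) * (w q.1 + w q.2)) x := by
          refine Pop_mono hG ((BddMeas.const 1).add ((BddMeas.const _).mul hw.children))
            (fun q => ?_) x
          have ht0 : 0 ≤ w q.1 + w q.2 := add_nonneg (h0 _) (h0 _)
          have ht : w q.1 + w q.2 ≤ 2 * K := by linarith [hK q.1, hK q.2]
          have h1 := Real.one_sub_le_exp_neg (w q.1 + w q.2)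
          have h2 : Real.exp (w q.1 + w q.2) * (1 - (w q.1 + w q.2)) ≤ 1 := by
            calc _ ≤ Real.exp (w q.1 + w q.2) * Real.exp (-(w q.1 + w q.2)) := by gcongr
              _ = 1 := by rw [← Real.exp_add]; simp
          have h3 : Real.exp (w q.1 + w q.2) * (w q.1 + w q.2) ≤
              Real.exp (2 * K) * (w q.1 + w q.2) := by gcongr
          linarith
      _ = 1 + Real.exp (2 * K) * (2 * Qop P w x) := by
          rw [two_mul_Qop, ← Pop_const_mul]
          simp only [Pop]
          rw [integral_add (integrable_const _)
            (((BddMeas.const _).mul hw.children).integrable _)]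
          simp
      _ ≤ 2 * (Real.exp (2 * K) * η) + 1 := by
          have : Real.exp (2 * K) * Qop P w x ≤ Real.exp (2 * K) * η := by gcongr; exact hη x
          linarith
      _ ≤ _ := Real.add_one_le_exp _
  have hMA : BddMeas (MA X (gen (k + 1)) w) := hw.MA hX.meas _
  have hmgf : mgf (MA X (gen (k + 1)) w) Pr 1 ≤
      Real.exp (2 ^ (k + 1) * (Real.exp (2 * K) * η)) := by
    have h := hX.integral_prod_children k (fun _ q => Real.exp (w q.1 + w q.2)) fun _ => hG
    have hprod : mgf (MA X (gen (k + 1)) w) Pr 1 =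
        ∫ ω, ∏ i ∈ gen k, Pop P (fun q => Real.exp (w q.1 + w q.2)) (X i ω) ∂Pr := by
      rw [← h]
      simp only [mgf, one_mul, MA_gen_succ, Real.exp_sum]
    rw [hprod]
    refine (le_abs_self _).trans (abs_integral_le_of_abs_le _ fun ω => ?_)
    have hpos : ∀ i, 0 ≤ Pop P (fun q => Real.exp (w q.1 + w q.2)) (X i ω) := fun i =>
      integral_nonneg fun q => (Real.exp_pos _).le
    rw [abs_of_nonneg (Finset.prod_nonneg fun i _ => hpos i)]
    refine (Finset.prod_le_prod (fun i _ => hpos i) fun i _ => hpop _).trans_eq ?_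
    rw [Finset.prod_const, card_gen, ← Real.exp_nat_mul]
    congr 1
    push_cast
    ring
  have hch := measure_ge_le_exp_mul_mgf (μ := Pr) (X := MA X (gen (k + 1)) w) (t * 2 ^ (k + 1))
    zero_le_one (by simpa using hMA.exp.integrable Pr)
  rw [← ENNReal.ofReal_toReal (measure_ne_top Pr _)]
  refine ENNReal.ofReal_le_ofReal (hch.trans ?_)
  calc _ ≤ Real.exp (-1 * (t * 2 ^ (k + 1))) *
        Real.exp (2 ^ (k + 1) * (Real.exp (2 * K) * η)) := by gcongr
    _ = _ := by rw [← Real.exp_add]; congr 1; ring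

theorem FnAssump.exists_bound {P : Kernel (Fin d → ℝ) ((Fin d → ℝ) × (Fin d → ℝ))}
    [IsMarkovKernel P] {μm : Measure (Fin d → ℝ)} [IsProbabilityMeasure μm]
    (hinv : IsInvariantQ P μm) {M α : ℝ} (hM : 0 < M) (hα0 : 0 < α) (herg : ErgodicQ P μm M α)
    {γ : ℝ} (hγ0 : 0 < γ) {f : ℕ → ℕ → (Fin d → ℝ) → ℝ} {σ2 : ℝ} (hf : FnAssump P μm γ f σ2) :
    ∃ K : ℝ, 0 < K ∧ ∀ n, ∀ ℓ ≤ n, BddMeas (tilde μm (f n ℓ)) ∧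
      (∀ x, bandwidth γ n ^ ((d : ℝ) / 2) * |tilde μm (f n ℓ) x| ≤ K) ∧
      (∀ x, Qop P (fun y => |tilde μm (f n ℓ) y|) x ≤ K) ∧
      ∀ q x, |(Qop P)^[q + 1] (tilde μm (f n ℓ)) x| ≤
        K * bandwidth γ n ^ ((d : ℝ) / 2) * α ^ (q + 1) := by
  obtain ⟨hmeas, -, ⟨C₁, hC₁⟩, ⟨C₂, hC₂⟩, -⟩ := hf
  set C := max 1 (max C₁ C₂)
  have hC1 : 1 ≤ C := le_max_left _ _
  have hC1C : C₁ ≤ C := (le_max_left _ _).trans (le_max_right _ _)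
  have hC2C : C₂ ≤ C := (le_max_right _ _).trans (le_max_right _ _)
  refine ⟨2 * C + 2 * C * M / α, by positivity, fun n ℓ hℓ => ?_⟩
  have hb0 : 0 < bandwidth γ n := Real.rpow_pos_of_pos two_pos _
  have hb1 : bandwidth γ n ≤ 1 := by
    refine Real.rpow_le_one_of_one_le_of_nonpos one_le_two ?_
    rw [neg_mul, neg_nonpos]
    positivity
  set h := bandwidth γ n ^ ((d : ℝ) / 2)
  have hh0 : 0 < h := Real.rpow_pos_of_pos hb0 _
  have hh1 : h ≤ 1 := Real.rpow_le_one hb0.le hb1 (by positivity)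
  obtain ⟨hsup, hQ, hQ2, -⟩ := hC₁ n ℓ hℓ
  obtain ⟨hL1, -⟩ := hC₂ n ℓ hℓ
  have hfb : BddMeas (f n ℓ) :=
    ⟨hmeas n ℓ, C₁ / h, fun x => by rw [le_div_iff₀ hh0, mul_comm]; exact hsup x⟩
  set c := ∫ y, f n ℓ y ∂μm with hc
  have hcle : |c| ≤ C * h := (abs_integral_le_integral_abs).trans (hL1.trans (by gcongr))
  have hcC : |c| ≤ C := hcle.trans (mul_le_of_le_one_right (by positivity) hh1)
  have htilde : tilde μm (f n ℓ) = fun x => f n ℓ x - c := rfl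
  have htb : BddMeas (tilde μm (f n ℓ)) := hfb.sub (BddMeas.const c)
  have htri : ∀ x, |tilde μm (f n ℓ) x| ≤ |f n ℓ x| + C := fun x =>
    (abs_sub _ _).trans (by gcongr)
  have hK : 2 * C ≤ 2 * C + 2 * C * M / α := le_add_of_nonneg_right (by positivity)
  refine ⟨htb, fun x => le_trans ?_ hK, fun x => le_trans ?_ hK, fun q x => ?_⟩
  · have h1 := mul_le_mul_of_nonneg_left (htri x) hh0.le
    have h2 := hsup x
    have h3 : h * C ≤ C := mul_le_of_le_one_left (by positivity) hh1
    linarith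
  · have hsq : BddMeas fun y => f n ℓ y ^ 2 := by simpa only [sq] using hfb.mul hfb
    calc _ ≤ Qop P (fun y => 2⁻¹ * f n ℓ y ^ 2 + (2⁻¹ + C)) x := by
          refine Qop_mono htb.abs (((BddMeas.const _).mul hsq).add (BddMeas.const _))
            (fun y => (htri y).trans ?_) x
          nlinarith [sq_nonneg (|f n ℓ y| - 1), sq_abs (f n ℓ y)]
      _ = 2⁻¹ * Qop P (fun y => f n ℓ y ^ 2) x + (2⁻¹ + C) := by
          rw [Qop_add_const ((BddMeas.const _).mul hsq), Qop_const_mul]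
      _ ≤ 2 * C := by linarith [le_of_abs_le (hQ2 x)]
  · have hQt : ∀ x, |Qop P (tilde μm (f n ℓ)) x| ≤ 2 * C * h := by
      intro x
      rw [htilde]
      simp only [sub_eq_add_neg]
      rw [Qop_add_const hfb, ← sub_eq_add_neg]
      have h1 := hQ x
      have h2 : C₁ * h ≤ C * h := by gcongr
      exact (abs_sub _ _).trans (by linarith)
    have hzero : ∫ y, Qop P (tilde μm (f n ℓ)) y ∂μm = 0 := by
      rw [hinv _ htb.1 htb.2, htilde, integral_sub (hfb.integrable _) (integrable_const _), ← hc]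
      simp
    have he := herg _ _ htb.qop.1 hQt q x
    rw [hzero, sub_zero, ← Function.iterate_succ_apply] at he
    refine he.trans ?_
    calc M * α ^ q * (2 * C * h) = 2 * C * M / α * h * α ^ (q + 1) := by
          rw [pow_succ]; field_simp
      _ ≤ _ := by gcongr; linarith

section SmallGenerations

variable {Ω : Type*} [MeasurableSpace Ω] {Pr : Measure Ω} [IsProbabilityMeasure Pr]
  {X : Word → Ω → (Fin d → ℝ)} {P : Kernel (Fin d → ℝ) ((Fin d → ℝ) × (Fin d → ℝ))}
  [IsMarkovKernel P] {u v : (Fin d → ℝ) → ℝ} {K h α : ℝ}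

theorem IsBMC.abs_integral_MA_mul_root_le {x : Fin d → ℝ}
    (hX : IsBMC Pr X (Measure.dirac x) P) (hu : BddMeas u) (hv : BddMeas v) {t : ℕ} {B : ℝ}
    (hB : ∀ y, |(Qop P)^[t] u y| ≤ B) :
    |∫ ω, MA X (gen t) u ω * MA X (gen 0) v ω ∂Pr| ≤ 2 ^ t * (B * |v x|) := by
  have h := hX.integral_MA_add_mul_MA hu hv 0 t
  rw [zero_add] at h
  have hm : BddMeas fun y => (Qop P)^[t] u y * v y := (hu.qop_iterate t).mul hv
  have hroot : ∫ ω, MA X (gen 0) ((Qop P)^[t] u) ω * MA X (gen 0) v ω ∂Pr =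
      (Qop P)^[t] u x * v x := by
    simp only [MA, gen_zero, Finset.sum_singleton]
    rw [← integral_map (f := fun y => (Qop P)^[t] u y * v y) (hX.meas []).aemeasurable
      hm.1.aestronglyMeasurable, hX.init, integral_dirac]
  rw [h, hroot, abs_mul, abs_mul, abs_of_nonneg (by positivity : (0 : ℝ) ≤ 2 ^ t)]
  gcongr
  exact hB x

theorem IsBMC.abs_integral_MA_add_mul_MA_succ_le {ν : Measure (Fin d → ℝ)}
    (hX : IsBMC Pr X ν P) (hu : BddMeas u) (hv : BddMeas v)
    (hα0 : 0 ≤ α) (hα1 : α ≤ 1) {θ : ℝ} (hθ1 : 1 ≤ θ) (hθ : 2 * α ^ 2 ≤ θ)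
    (hKu : ∀ q x, |(Qop P)^[q + 1] u x| ≤ K * h * α ^ (q + 1))
    (hKv : ∀ q x, |(Qop P)^[q + 1] v x| ≤ K * h * α ^ (q + 1))
    (hv1 : ∀ x, Qop P (fun y => |v y|) x ≤ K) (hK : 0 ≤ K) (hh : 0 ≤ h) (r t : ℕ) :
    |∫ ω, MA X (gen (r + 1 + (t + 1))) u ω * MA X (gen (r + 1)) v ω ∂Pr| ≤
      2 ^ (r + 1 + (t + 1)) *
        (4 * K ^ 2 * h + 2 * K ^ 2 * h ^ 2 * ((4 * r + 1) * θ ^ r)) := by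
  have hαt : ∀ m : ℕ, α ^ m ≤ 1 := fun m => pow_le_one₀ hα0 hα1
  have hsup : ∀ x, |(Qop P)^[t + 1] u x| ≤ K * h := fun x =>
    (hKu t x).trans (mul_le_of_le_one_right (by positivity) (hαt _))
  have h1 := hX.abs_integral_MA_succ_mul_MA_succ_le hv (hu.qop_iterate (t + 1)) hv1 hsup r
  have h2 := hX.abs_integral_MA_mul_MA_le hv.qop (hu.qop_iterate (t + 1)).qop
    (A := K * h) (B := K * h) hθ1 hθ
    (fun q x => by
      rw [← Function.iterate_succ_apply]
      refine (hKv q x).trans ?_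
      gcongr K * h * ?_
      exact pow_le_pow_of_le_one hα0 hα1 q.le_succ)
    (fun q x => by
      rw [← Function.iterate_succ_apply' (Qop P), ← Function.iterate_add_apply]
      refine (hKu (q + (t + 1)) x).trans ?_
      gcongr K * h * ?_
      exact pow_le_pow_of_le_one hα0 hα1 (by lia)) r
  rw [hX.integral_MA_add_mul_MA hu hv, abs_mul, abs_of_nonneg (by positivity : (0 : ℝ) ≤ 2 ^ _)]
  simp only [mul_comm (MA X (gen (r + 1)) ((Qop P)^[t + 1] u) _)]
  calc _ ≤ 2 ^ (t + 1) * (4 * (K * h * (K * h) * (2 ^ r * ((4 * r + 1) * θ ^ r))) +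
        2 ^ r * (8 * (K * (K * h)))) := by gcongr; exact h1.trans (by gcongr)
    _ = _ := by ring

end SmallGenerations

theorem IsBMC.abs_sum_integral_MA_mul_MA_le {Ω : Type*} [MeasurableSpace Ω] {Pr : Measure Ω}
    [IsProbabilityMeasure Pr] {X : Word → Ω → (Fin d → ℝ)}
    {P : Kernel (Fin d → ℝ) ((Fin d → ℝ) × (Fin d → ℝ))} [IsMarkovKernel P] {x : Fin d → ℝ}
    (hX : IsBMC Pr X (Measure.dirac x) P) {K h α θ : ℝ} (hα0 : 0 ≤ α) (hα1 : α ≤ 1)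
    (hθ1 : 1 ≤ θ) (hθ : 2 * α ^ 2 ≤ θ) (hK : 0 ≤ K) (hh : 0 ≤ h) {p N : ℕ} (hpN : p ≤ N)
    {F : ℕ → (Fin d → ℝ) → ℝ} (hF : ∀ ℓ ≤ p, BddMeas (F ℓ))
    (hF1 : ∀ ℓ ≤ p, ∀ x, Qop P (fun y => |F ℓ y|) x ≤ K)
    (hFq : ∀ ℓ ≤ p, ∀ q x, |(Qop P)^[q + 1] (F ℓ) x| ≤ K * h * α ^ (q + 1)) :
    |∑ q ∈ (Finset.range (p + 1) ×ˢ Finset.range (p + 1)).filter (fun q : ℕ × ℕ => q.1 < q.2),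
        ∫ ω, MA X (gen (p - q.1)) (F q.1) ω * MA X (gen (p - q.2)) (F q.2) ω ∂Pr| ≤
      2 ^ p * ((N + 1) ^ 2 * (4 * K ^ 2 * h + 2 * K ^ 2 * h ^ 2 * ((4 * N + 1) * θ ^ N)) +
        2 * K * (h * |F p x|)) := by
  set c := 4 * K ^ 2 * h + 2 * K ^ 2 * h ^ 2 * ((4 * N + 1) * θ ^ N) with hc
  have hc0 : 0 ≤ c := by positivity
  set e := K * h * |F p x| with he
  have he0 : 0 ≤ e := by positivity
  have hpair : ∀ q ∈ (Finset.range (p + 1) ×ˢ Finset.range (p + 1)).filter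
      (fun q : ℕ × ℕ => q.1 < q.2),
      |∫ ω, MA X (gen (p - q.1)) (F q.1) ω * MA X (gen (p - q.2)) (F q.2) ω ∂Pr| ≤
        2 ^ p * (c + if q.2 = p then (1 / 2 : ℝ) ^ q.1 * e else 0) := by
    rintro ⟨ℓ, k⟩ hq
    simp only [Finset.mem_filter, Finset.mem_product, Finset.mem_range, Nat.lt_succ_iff] at hq ⊢
    obtain ⟨⟨hℓ, hk⟩, hlk⟩ := hq
    obtain ⟨t, rfl⟩ : ∃ t, k = ℓ + (t + 1) := ⟨k - ℓ - 1, by lia⟩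
    obtain ⟨r, rfl⟩ : ∃ r, p = ℓ + (t + 1) + r := ⟨p - (ℓ + (t + 1)), by lia⟩
    have hsup : ∀ x, |(Qop P)^[t + 1] (F ℓ) x| ≤ K * h := fun x =>
      (hFq ℓ hℓ t x).trans (mul_le_of_le_one_right (by positivity) (pow_le_one₀ hα0 hα1))
    rcases r with _ | r
    · rw [add_zero, Nat.sub_self, Nat.add_sub_cancel_left, if_pos rfl]
      refine (hX.abs_integral_MA_mul_root_le (hF _ hℓ) (hF _ hk) hsup).trans ?_
      calc (2 : ℝ) ^ (t + 1) * (K * h * |F (ℓ + (t + 1)) x|)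
          = 2 ^ (ℓ + (t + 1)) * ((1 / 2 : ℝ) ^ ℓ * e) := by
            rw [he, pow_add 2 ℓ, one_div, inv_pow]
            simp only [add_zero]
            field_simp
        _ ≤ _ := by gcongr; linarith
    · rw [if_neg (by lia), add_zero, show ℓ + (t + 1) + (r + 1) - ℓ = r + 1 + (t + 1) by lia,
        show ℓ + (t + 1) + (r + 1) - (ℓ + (t + 1)) = r + 1 by lia]
      refine (hX.abs_integral_MA_add_mul_MA_succ_le (hF _ hℓ) (hF _ hk) hα0 hα1 hθ1 hθ
        (hFq _ hℓ) (hFq _ hk) (hF1 _ hk) hK hh r t).trans ?_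
      have hrN : r ≤ N := by lia
      have hpow : (2 : ℝ) ^ (r + 1 + (t + 1)) ≤ 2 ^ (ℓ + (t + 1) + (r + 1)) :=
        pow_le_pow_right₀ one_le_two (by lia)
      have hθr : θ ^ r ≤ θ ^ N := pow_le_pow_right₀ hθ1 hrN
      have hr : (r : ℝ) ≤ N := by exact_mod_cast hrN
      have hθ0 : 0 ≤ θ := zero_le_one.trans hθ1
      exact mul_le_mul hpow (by rw [hc]; gcongr) (by positivity) (by positivity)
  refine (Finset.abs_sum_le_sum_abs _ _).trans ((Finset.sum_le_sum hpair).trans ?_)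
  rw [← Finset.mul_sum]
  gcongr
  refine (Finset.sum_le_sum_of_subset_of_nonneg (Finset.filter_subset _ _) fun q _ _ => ?_).trans
    ?_
  · split_ifs <;> positivity
  · rw [Finset.sum_add_distrib, Finset.sum_product (Finset.range (p + 1)) (Finset.range (p + 1))
      fun q : ℕ × ℕ => if q.2 = p then (1 / 2 : ℝ) ^ q.1 * e else 0]
    simp only [Finset.sum_const, Finset.card_product, Finset.card_range, nsmul_eq_mul,
      Finset.sum_ite_eq', Finset.mem_range, Nat.lt_succ_self, if_true, ← Finset.sum_mul]
    have hgeo := sum_geometric_two_le (p + 1)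
    have hp : (p : ℝ) ≤ N := by exact_mod_cast hpN
    refine add_le_add ?_ ?_
    · push_cast
      rw [← sq]
      gcongr
    · calc _ ≤ 2 * e := by gcongr
        _ = _ := by rw [he]; ring

theorem tendsto_pow_mul_pow_polynomial {a b K : ℝ} (ha0 : 0 ≤ a) (ha1 : a < 1) (hb0 : 0 ≤ b)
    (hb1 : a ^ 2 * b < 1) :
    Tendsto (fun n : ℕ => ((n : ℝ) + 1) ^ 2 *
      (4 * K ^ 2 * a ^ n + 2 * K ^ 2 * (a ^ n) ^ 2 * ((4 * n + 1) * b ^ n))) atTop (nhds 0) := by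
  have hA := fun j => tendsto_pow_const_mul_const_pow_of_abs_lt_one j (r := a)
    (by rwa [abs_of_nonneg ha0])
  have hB := fun j => tendsto_pow_const_mul_const_pow_of_abs_lt_one j (r := a ^ 2 * b)
    (by rwa [abs_of_nonneg (by positivity)])
  have h := ((((hA 2).add ((hA 1).const_mul 2)).add (hA 0)).const_mul (4 * K ^ 2)).add
    ((((((hB 3).const_mul 4).add ((hB 2).const_mul 9)).add ((hB 1).const_mul 6)).add
      (hB 0)).const_mul (2 * K ^ 2))
  simp only [mul_zero, add_zero] at h
  refine h.congr fun n => ?_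
  rw [mul_pow, ← pow_mul, ← pow_mul, mul_comm 2 n]
  ring

theorem limsup_inv_mul_log_eq_bot {u : ℕ → ENNReal} {b a : ℕ → ℝ} {c : ℝ} (hc : 0 < c)
    (ha : Tendsto (fun n => a n / b n ^ 2) atTop atTop)
    (hu : ∀ᶠ n in atTop, u n ≤ ENNReal.ofReal (Real.exp (-(a n * c)))) :
    limsup (fun n => (((b n ^ 2)⁻¹ : ℝ) : EReal) * ENNReal.log (u n)) atTop = ⊥ := by
  have hlim : Tendsto (fun n => ((-(a n / b n ^ 2 * c) : ℝ) : EReal)) atTop (nhds ⊥) :=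
    EReal.tendsto_coe_nhds_bot_iff.2
      (tendsto_neg_atTop_atBot.comp (ha.atTop_mul_const hc))
  refine le_bot_iff.1 (hlim.limsup_eq ▸ limsup_le_limsup ?_)
  filter_upwards [hu] with n hn
  have hlog : ENNReal.log (u n) ≤ ((-(a n * c) : ℝ) : EReal) := by
    simpa [ENNReal.log_ofReal_of_pos (Real.exp_pos _)] using ENNReal.log_le_log hn
  calc _ ≤ (((b n ^ 2)⁻¹ : ℝ) : EReal) * ((-(a n * c) : ℝ) : EReal) :=
        mul_le_mul_of_nonneg_left hlog (EReal.coe_nonneg.2 (by positivity))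
    _ = _ := by rw [← EReal.coe_mul]; congr 1; ring

theorem PCond.tendsto_div {p : ℕ → ℕ} {b : ℕ → ℝ} (hp : PCond p b) (hb : ∀ n, 0 < b n) :
    Tendsto (fun n => (2 : ℝ) ^ (n - p n) / b n ^ 2) atTop atTop := by
  have h0 : Tendsto (fun n => b n ^ 2 / (2 : ℝ) ^ (n - p n)) atTop (nhds 0) := by
    refine squeeze_zero (fun n => by positivity) (fun n => ?_) hp.2.2.2
    have h1 : (1 : ℝ) ≤ (p n : ℝ) ^ 3 := one_le_pow₀ (by exact_mod_cast hp.2.1 n)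
    gcongr
    exact le_mul_of_one_le_left (by positivity) h1
  have h1 : Tendsto (fun n => b n ^ 2 / (2 : ℝ) ^ (n - p n)) atTop (nhdsWithin 0 (Set.Ioi 0)) :=
    tendsto_nhdsWithin_iff.2 ⟨h0, Eventually.of_forall fun n => by
      have := hb n
      simp only [Set.mem_Ioi]
      positivity⟩
  refine h1.inv_tendsto_nhdsGT_zero.congr fun n => ?_
  simp

/-- Lemma 5.6: superexponential convergence of V₂(n) to 0. -/
theorem bracket_V2_superexp
    {d : ℕ} (hd : 1 ≤ d)
    {Ω : Type*} [MeasurableSpace Ω] (Pr : Measure Ω) [IsProbabilityMeasure Pr]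
    (X : Word → Ω → (Fin d → ℝ)) (ν : Measure (Fin d → ℝ)) [IsProbabilityMeasure ν]
    (P : Kernel (Fin d → ℝ) ((Fin d → ℝ) × (Fin d → ℝ))) [IsMarkovKernel P]
    (hBMC : IsBMC Pr X ν P)
    (μm : Measure (Fin d → ℝ)) [IsProbabilityMeasure μm] (hinv : IsInvariantQ P μm)
    (M α : ℝ) (hM : 0 < M) (hα0 : 0 < α) (hα1 : α < 1) (herg : ErgodicQ P μm M α)
    (γ : ℝ) (hγ0 : 0 < γ) (hγd : γ < 1 / (d : ℝ))
    (f : ℕ → ℕ → (Fin d → ℝ) → ℝ) (σ2 : ℝ) (hf : FnAssump P μm γ f σ2)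
    (hα2 : 1 / 2 < α →
      Tendsto (fun n : ℕ => ((2 : ℝ) ^ (1 - (d : ℝ) * γ) * α) ^ n) atTop (nhds 0))
    (s : ℝ) (hs : 0 < s) (b : ℕ → ℝ) (hb : SpeedCond b γ s d)
    (p : ℕ → ℕ) (hp : PCond p b)
    {Ω' : Type*} [MeasurableSpace Ω'] (X' : Word → Ω' → (Fin d → ℝ))
    (Prx : (Fin d → ℝ) → Measure Ω') (hPrxP : ∀ y, IsProbabilityMeasure (Prx y))
    (hfam : ∀ y, IsBMC (Prx y) X' (Measure.dirac y) P) :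
    ∀ δ > (0 : ℝ),
      Filter.limsup
        (fun n => (((b n ^ 2)⁻¹ : ℝ) : EReal) *
          ENNReal.log (Pr {ω |
            |((2 : ℝ) ^ n)⁻¹ * (∑ i ∈ gen (n - p n),
              ∑ q ∈ (Finset.range (p n + 1) ×ˢ Finset.range (p n + 1)).filter
                (fun q : ℕ × ℕ => q.1 < q.2),
              ∫ ω', (MA X' (gen (p n - q.1)) (tilde μm (f n q.1)) ω') *
                (MA X' (gen (p n - q.2)) (tilde μm (f n q.2)) ω') ∂(Prx (X i ω)))| > δ}))
        atTop = ⊥ := by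
  intro δ hδ
  have hd0 : (0 : ℝ) < d := by exact_mod_cast hd
  obtain ⟨K, hK0, hK⟩ := hf.exists_bound hinv hM hα0 herg hγ0
  have hb0 : ∀ n, 0 < b n := hb.1
  have hdiv := hp.tendsto_div hb0
  set a : ℝ := 2 ^ (-(γ * d / 2)) with ha
  have ha0 : 0 < a := Real.rpow_pos_of_pos two_pos _
  have ha1 : a < 1 :=
    Real.rpow_lt_one_of_one_lt_of_neg one_lt_two (neg_lt_zero.2 (by positivity))
  have hband : ∀ n, bandwidth γ n ^ ((d : ℝ) / 2) = a ^ n := by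
    intro n
    rw [bandwidth, ha, ← Real.rpow_mul two_pos.le, ← Real.rpow_mul_natCast two_pos.le]
    congr 1
    ring
  simp only [hband] at hK
  set θ := max 1 (2 * α ^ 2) with hθdef
  have hθ1 : 1 ≤ θ := le_max_left _ _
  have hθ : 2 * α ^ 2 ≤ θ := le_max_right _ _
  have ha2 : a ^ 2 < 1 := pow_lt_one₀ ha0.le ha1 two_ne_zero
  have haθ : a ^ 2 * θ < 1 := by
    rw [hθdef, mul_max_of_nonneg _ _ (sq_nonneg a), mul_one]
    refine max_lt ha2 ?_
    rcases le_or_gt α (1 / 2) with hα | hα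
    · nlinarith [sq_nonneg a]
    · have hlt := tendsto_pow_atTop_nhds_zero_iff.1 (hα2 hα)
      have hsq : a ^ 2 * 2 = 2 ^ (1 - (d : ℝ) * γ) := by
        rw [ha, ← Real.rpow_mul_natCast two_pos.le, sub_eq_neg_add,
          Real.rpow_add two_pos, Real.rpow_one]
        congr 2
        push_cast
        ring
      have h1 : a ^ 2 * 2 * α < 1 := hsq ▸ (le_abs_self _).trans_lt hlt
      have h2 : 0 < a ^ 2 * 2 * α := by positivity
      nlinarith
  have hε := tendsto_pow_mul_pow_polynomial (K := K) ha0.le ha1 (zero_le_one.trans hθ1) haθ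
  set t := δ / (4 * K) with ht
  have ht0 : 0 < t := by positivity
  have hη : Tendsto (fun n : ℕ => Real.exp (2 * K) * (a ^ n * K)) atTop (nhds 0) := by
    simpa using ((tendsto_pow_atTop_nhds_zero_of_lt_one ha0.le ha1).mul_const K).const_mul
      (Real.exp (2 * K))
  refine limsup_inv_mul_log_eq_bot (half_pos ht0) hdiv ?_
  filter_upwards [eventually_ge_atTop 1, hε.eventually_lt_const (half_pos hδ),
    hη.eventually_lt_const (half_pos ht0), hdiv.eventually_ge_atTop 1,
    hb.2.1.eventually_gt_atTop 1] with n hn hεn hηn hdivn hbn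
  have hpn : p n ≤ n := hp.2.2.1 n hn
  obtain ⟨k, hk⟩ : ∃ k, n - p n = k + 1 := by
    refine Nat.exists_eq_succ_of_ne_zero fun h0 => ?_
    rw [h0, pow_zero, le_div_iff₀ (by positivity)] at hdivn
    nlinarith
  set w : (Fin d → ℝ) → ℝ := fun x => a ^ n * |tilde μm (f n (p n)) x| with hw
  obtain ⟨hwb, hwK, hwQ, -⟩ := hK n (p n) hpn
  have hconc := hBMC.measure_le_MA_le ((BddMeas.const (a ^ n)).mul hwb.abs)
    (fun x => by positivity) hwK (η := a ^ n * K)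
    (fun x => by rw [Qop_const_mul]; gcongr; exact hwQ x) k t
  refine (measure_mono fun ω hω => ?_).trans (hconc.trans (ENNReal.ofReal_le_ofReal ?_))
  · simp only [Set.mem_ofPred_eq] at hω ⊢
    by_contra! hlt
    have hterm := fun i => (hfam (X i ω)).abs_sum_integral_MA_mul_MA_le (F := fun ℓ =>
      tilde μm (f n ℓ)) hα0.le hα1.le hθ1 hθ hK0.le (pow_pos ha0 n).le hpn
      (fun ℓ hℓ => (hK n ℓ (hℓ.trans hpn)).1) (fun ℓ hℓ => (hK n ℓ (hℓ.trans hpn)).2.2.1)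
      (fun ℓ hℓ => (hK n ℓ (hℓ.trans hpn)).2.2.2)
    have hsum := (Finset.abs_sum_le_sum_abs _ _).trans
      (Finset.sum_le_sum fun i (_ : i ∈ gen (n - p n)) => hterm i)
    rw [← Finset.mul_sum, Finset.sum_add_distrib, Finset.sum_const, card_gen, nsmul_eq_mul,
      ← Finset.mul_sum, hk] at hsum
    rw [hk, abs_mul, abs_of_pos (by positivity), gt_iff_lt, inv_mul_eq_div,
      lt_div_iff₀ (by positivity)] at hω
    have h2n : (2 : ℝ) ^ n = 2 ^ p n * 2 ^ (k + 1) := by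
      rw [← pow_add, ← hk, Nat.add_sub_cancel' hpn]
    have hcontra := hω.trans_le hsum
    rw [h2n, mul_left_comm, mul_lt_mul_iff_right₀ (by positivity)] at hcontra
    have h1 : 2 * K * MA X (gen (k + 1)) w ω < 2 * K * (t * 2 ^ (k + 1)) := by gcongr
    have h2 : 2 * K * (t * 2 ^ (k + 1)) = δ / 2 * 2 ^ (k + 1) := by
      rw [ht]; field_simp; ring
    have h3 := mul_lt_mul_of_pos_left hεn (by positivity : (0 : ℝ) < 2 ^ (k + 1))
    simp only [MA, hw] at h1
    push_cast at hcontra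
    linarith
  · rw [hk]
    refine Real.exp_le_exp.2 (neg_le_neg ?_)
    gcongr
    linarith

end BMC
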